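/- arXiv:0908.3553 — 3 statements merged into one kernel-verified Lean document; each statement's English description precedes it below -/
import Mathlib

section
/- Let m ≥ 1, let C > 0, Λ > 0 and h > 0 be reals, let W : ℝ → [0, ∞) satisfy W(0) > 0 and W(z) = 0 whenever |z| > C, and let v_1, …, v_m ∈ [0, 1]. For each i ∈ {1, …, m} define the Nadaraya–Watson smoothed value p̂_i = [∑_{j=1}^m W(Λ(i−j)/(m h)) · v_j] / [∑_{j=1}^m W(Λ(i−j)/(m h))]. Then |p̂_i − v_i| ≤ 2 C m h / Λ for every i; in particular the deviation of the smoothed estimate from v_i is of order O(h). -/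
/-- The Nadaraya–Watson smoothed value p̂_i deviates from v_i by at most
2·C·m·h/Λ, when the kernel W has support contained in [−C, C] and the
values v_j lie in [0, 1]. -/
theorem nadaraya_watson_deviation (m : ℕ) (hm : 1 ≤ m) (C Λ h : ℝ)
    (hC : 0 < C) (hΛ : 0 < Λ) (hh : 0 < h)
    (W : ℝ → ℝ) (hWnonneg : ∀ z : ℝ, 0 ≤ W z) (hW0 : 0 < W 0)
    (hWsupp : ∀ z : ℝ, C < |z| → W z = 0)
    (v : Fin m → ℝ) (hv : ∀ i : Fin m, v i ∈ Set.Icc (0 : ℝ) 1) :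
    ∀ i : Fin m,
      |(∑ j : Fin m, W (Λ * ((i : ℝ) - (j : ℝ)) / (m * h)) * v j) /
          (∑ j : Fin m, W (Λ * ((i : ℝ) - (j : ℝ)) / (m * h))) - v i|
        ≤ 2 * C * m * h / Λ := by
  intro i
  have hm0 : (0 : ℝ) < m := by exact_mod_cast hm
  have hB : 0 ≤ 2 * C * m * h / Λ := by positivity
  set w : Fin m → ℝ := fun j => W (Λ * ((i : ℝ) - (j : ℝ)) / (m * h)) with hw
  have hwn : ∀ j, 0 ≤ w j := fun j => hWnonneg _
  have hwi : 0 < w i := by simpa [hw] using hW0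
  have hS : 0 < ∑ j, w j :=
    Finset.sum_pos' (fun j _ => hwn j) ⟨i, Finset.mem_univ i, hwi⟩
  have key : ∀ j, w j * |v j - v i| ≤ w j * (2 * C * m * h / Λ) := by
    intro j
    by_cases hji : j = i
    · subst hji
      simpa using mul_nonneg (hwn j) hB
    by_cases hz : w j = 0
    · simp [hz]
    refine mul_le_mul_of_nonneg_left ?_ (hwn j)
    have h1 : |v j - v i| ≤ 1 := by
      have a := hv j
      have b := hv i
      rw [abs_le]
      constructor <;> linarith [a.1, a.2, b.1, b.2]
    have h2 : |Λ * ((i : ℝ) - (j : ℝ)) / (m * h)| ≤ C := by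
      by_contra hc
      exact hz (hWsupp _ (not_le.mp hc))
    have h3 : (1 : ℝ) ≤ |(i : ℝ) - (j : ℝ)| := by
      have hne : ((i : ℕ) : ℤ) - ((j : ℕ) : ℤ) ≠ 0 := by
        intro h0
        apply hji
        ext
        omega
      have := Int.one_le_abs hne
      exact_mod_cast this
    rw [abs_div, abs_mul, abs_of_pos hΛ, abs_of_pos (mul_pos hm0 hh),
      div_le_iff₀ (mul_pos hm0 hh)] at h2
    refine h1.trans ?_
    rw [le_div_iff₀ hΛ]
    nlinarith [mul_le_mul_of_nonneg_left h3 hΛ.le]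
  have e : (∑ j, w j * v j) / (∑ j, w j) - v i = (∑ j, w j * (v j - v i)) / ∑ j, w j := by
    simp only [mul_sub, Finset.sum_sub_distrib, ← Finset.sum_mul]
    field_simp
  change |(∑ j, w j * v j) / (∑ j, w j) - v i| ≤ _
  rw [e, abs_div, abs_of_pos hS, div_le_iff₀ hS]
  calc |∑ j, w j * (v j - v i)| ≤ ∑ j, |w j * (v j - v i)| := Finset.abs_sum_le_sum_abs _ _
    _ = ∑ j, w j * |v j - v i| := by
      refine Finset.sum_congr rfl fun j _ => ?_
      rw [abs_mul, abs_of_nonneg (hwn j)]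
    _ ≤ ∑ j, w j * (2 * C * m * h / Λ) := Finset.sum_le_sum fun j _ => key j
    _ = 2 * C * m * h / Λ * ∑ j, w j := by rw [← Finset.sum_mul, mul_comm]
end

section
/- Let w_1, …, w_m > 0 and let π_1, …, π_m satisfy 0 < π_i < 1 and ∑_i π_i = 1. For θ ∈ ℝ^m set S_i(θ) = w_i e^{−θ_i}, S(θ) = ∑_k S_k(θ), h_i(θ) = S_i/S − π_i, and v(θ) = (1/2) ∑_k (S_k/S − π_k)². Then the Lyapunov derivative satisfies v̇(θ) := ∑_{i=1}^m (∂v/∂θ_i)(θ) · h_i(θ) = −( ∑_{i=1}^m (S_i/S)(S_i/S − π_i)² − μ² ) = −σ² ≤ 0, where μ = ∑_i (S_i/S)(S_i/S − π_i) and σ² is the variance of the random variable taking value S_i/S − π_i with probability S_i/S; moreover v̇(θ) = 0 if and only if S_i/S = π_i for all i, and v̇(θ) < 0 otherwise. -/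
theorem samc_partial (m : ℕ) (w π θ : Fin m → ℝ) (i : Fin m)
    (hS : 0 < ∑ k : Fin m, w k * Real.exp (-(θ k)))
    (p : Fin m → ℝ)
    (hp : ∀ i : Fin m, p i =
      (w i * Real.exp (-(θ i))) / (∑ k : Fin m, w k * Real.exp (-(θ k)))) :
    deriv (fun s : ℝ => (1 / 2 : ℝ) *
          ∑ k : Fin m,
            ((w k * Real.exp (-(Function.update θ i s k))) /
                (∑ l : Fin m, w l * Real.exp (-(Function.update θ i s l)))
              - π k) ^ 2) (θ i)
      = p i * (∑ k, p k * (p k - π k)) - p i * (p i - π i) := by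
  have ha : ∀ k, HasDerivAt (fun s : ℝ => w k * Real.exp (-(Function.update θ i s k)))
      (if k = i then -(w i * Real.exp (-(θ i))) else 0) (θ i) := by
    intro k
    by_cases h : k = i
    · subst h
      simp only [Function.update_self, if_true]
      have := ((hasDerivAt_id (θ k)).neg.exp).const_mul (w k)
      simpa using this
    · simp only [Function.update_of_ne h, if_neg h]
      exact hasDerivAt_const _ _
  have hSd : HasDerivAt (fun s : ℝ => ∑ l, w l * Real.exp (-(Function.update θ i s l)))
      (-(w i * Real.exp (-(θ i)))) (θ i) := by
    have := HasDerivAt.fun_sum (u := Finset.univ) (fun k _ => ha k)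
    simpa using this
  have hq : ∀ k, HasDerivAt (fun s : ℝ => ((w k * Real.exp (-(Function.update θ i s k))) /
                (∑ l : Fin m, w l * Real.exp (-(Function.update θ i s l)))
              - π k) ^ 2) (2 * (p k - π k) * (p k * p i - if k = i then p i else 0)) (θ i) := by
    intro k
    have := (((ha k).div hSd (by simpa using hS.ne')).sub_const (π k)).pow 2
    refine this.congr_deriv ?_
    simp only [Function.update_eq_self, Pi.div_apply, ← hp]
    have hi := hp i
    have hk := hp k
    have ei : w i * Real.exp (-(θ i)) = p i * ∑ k, w k * Real.exp (-(θ k)) := by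
      rw [hi]; field_simp
    have ek : w k * Real.exp (-(θ k)) = p k * ∑ k, w k * Real.exp (-(θ k)) := by
      rw [hk]; field_simp
    rw [ei, ek]
    generalize (∑ k, w k * Real.exp (-(θ k))) = S at *
    have := hS.ne'
    split_ifs <;> field_simp <;> push_cast <;> ring
  have := (HasDerivAt.fun_sum (u := Finset.univ) (fun k _ => hq k)).const_mul (1 / 2 : ℝ)
  rw [this.deriv]
  have e : ∀ k, 2 * (p k - π k) * (p k * p i - if k = i then p i else 0)
      = 2 * p i * (p k * (p k - π k)) - if k = i then 2 * p i * (p i - π i) else 0 := by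
    intro k
    by_cases h : k = i
    · subst h; simp; ring
    · simp [h]; ring
  simp only [e, Finset.sum_sub_distrib, ← Finset.mul_sum]
  simp
  ring

/-- The Lyapunov derivative of the SAMC Lyapunov function
v(θ) = (1/2)∑_k (S_k/S − π_k)² along the mean field h_i(θ) = S_i/S − π_i
(where S_i(θ) = w_i e^{−θ_i}, S(θ) = ∑_k S_k(θ)) satisfies
v̇(θ) = ∑_i (∂v/∂θ_i)·h_i(θ) = −(∑_i (S_i/S)(S_i/S − π_i)² − μ²) = −σ² ≤ 0,
where μ = ∑_i (S_i/S)(S_i/S − π_i) and σ² is the variance of the random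
variable taking value S_i/S − π_i with probability S_i/S; moreover
v̇(θ) = 0 if and only if S_i/S = π_i for all i (and v̇(θ) < 0 otherwise). -/
theorem samc_lyapunov_derivative (m : ℕ) (w π : Fin m → ℝ)
    (hw : ∀ i : Fin m, 0 < w i)
    (hπ : ∀ i : Fin m, 0 < π i ∧ π i < 1) (hπsum : ∑ i : Fin m, π i = 1)
    (θ : Fin m → ℝ)
    (p : Fin m → ℝ)
    (hp : ∀ i : Fin m, p i =
      (w i * Real.exp (-(θ i))) / (∑ k : Fin m, w k * Real.exp (-(θ k))))
    (vdot : ℝ)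
    (hvdot : vdot = ∑ i : Fin m,
      deriv
        (fun s : ℝ => (1 / 2 : ℝ) *
          ∑ k : Fin m,
            ((w k * Real.exp (-(Function.update θ i s k))) /
                (∑ l : Fin m, w l * Real.exp (-(Function.update θ i s l)))
              - π k) ^ 2)
        (θ i) * (p i - π i)) :
    vdot = -((∑ i : Fin m, p i * (p i - π i) ^ 2) -
        (∑ i : Fin m, p i * (p i - π i)) ^ 2) ∧
    vdot ≤ 0 ∧
    (vdot = 0 ↔ ∀ i : Fin m, p i = π i) ∧
    ((¬ ∀ i : Fin m, p i = π i) → vdot < 0) := by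
  have hne : (Finset.univ : Finset (Fin m)).Nonempty := by
    rw [Finset.nonempty_iff_ne_empty]
    intro h
    rw [h] at hπsum
    simp at hπsum
  have hS : 0 < ∑ k : Fin m, w k * Real.exp (-(θ k)) :=
    Finset.sum_pos (fun k _ => mul_pos (hw k) (Real.exp_pos _)) hne
  have hpp : ∀ i, 0 < p i := fun i => by
    rw [hp i]; exact div_pos (mul_pos (hw i) (Real.exp_pos _)) hS
  have hps : ∑ i, p i = 1 := by
    simp only [hp]
    rw [← Finset.sum_div, div_self hS.ne']
  obtain ⟨μ, hμ⟩ : ∃ μ, μ = ∑ i, p i * (p i - π i) := ⟨_, rfl⟩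
  have h1 : vdot = -((∑ i : Fin m, p i * (p i - π i) ^ 2) - μ ^ 2) := by
    rw [hvdot]
    simp only [samc_partial m w π θ _ hS p hp, ← hμ]
    have e : ∀ i, (p i * μ - p i * (p i - π i)) * (p i - π i)
        = μ * (p i * (p i - π i)) - p i * (p i - π i) ^ 2 := fun i => by ring
    simp only [e, Finset.sum_sub_distrib, ← Finset.mul_sum, ← hμ]
    ring
  have h2 : vdot = -∑ i, p i * (p i - π i - μ) ^ 2 := by
    have e : ∀ i, p i * (p i - π i - μ) ^ 2
        = p i * (p i - π i) ^ 2 - 2 * μ * (p i * (p i - π i)) + μ ^ 2 * p i := fun i => by ring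
    simp only [e, Finset.sum_sub_distrib, Finset.sum_add_distrib, ← Finset.mul_sum, ← hμ, hps]
    rw [h1]; ring
  have hnn : ∀ i ∈ Finset.univ, 0 ≤ p i * (p i - π i - μ) ^ 2 :=
    fun i _ => mul_nonneg (hpp i).le (sq_nonneg _)
  have h3 : vdot ≤ 0 := by
    rw [h2]; exact neg_nonpos.mpr (Finset.sum_nonneg hnn)
  have h4 : vdot = 0 ↔ ∀ i : Fin m, p i = π i := by
    constructor
    · intro h
      rw [h2, neg_eq_zero, Finset.sum_eq_zero_iff_of_nonneg hnn] at h
      have h5 : ∀ i, p i - π i = μ := fun i => by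
        have := h i (Finset.mem_univ i)
        rcases mul_eq_zero.mp this with h | h
        · exact absurd h (hpp i).ne'
        · have := pow_eq_zero_iff (two_ne_zero) |>.mp h
          linarith
      have h6 : ∑ i, (p i - π i) = 0 := by
        rw [Finset.sum_sub_distrib, hps, hπsum, sub_self]
      simp only [h5] at h6
      rw [Finset.sum_const, smul_eq_zero] at h6
      have h7 : μ = 0 := h6.resolve_left (Finset.card_pos.mpr hne).ne'
      intro i
      linarith [h5 i]
    · intro h
      rw [h1, hμ]
      simp [h]
  rw [← hμ]
  exact ⟨h1, h3, h4, fun h => lt_of_le_of_ne h3 (fun h' => h (h4.mp h'))⟩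
end

section
/- Let n ≥ 1 be an integer, z_1, …, z_n ∈ ℝ, and α > 0, β > 0. Then the double integral ∫_ℝ ∫_0^∞ t^{−n/2 − α − 1} exp( −( β + (1/2) ∑_{j=1}^n (z_j − μ)² ) / t ) dt dμ converges and equals √(2π/n) · Γ( (n−1)/2 + α ) · [ β + (1/2) ∑_{j=1}^n z_j² − ( ∑_{j=1}^n z_j )² / (2n) ]^{ −( (n−1)/2 + α ) }, where Γ denotes the Gamma function. -/
open MeasureTheory Real

lemma invGamma_integral_aux (a B : ℝ) (ha : 0 < a) (hB : 0 < B) :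
    IntegrableOn (fun t : ℝ => t ^ (-a - 1) * Real.exp (-B / t)) (Set.Ioi 0) ∧
    ∫ t in Set.Ioi (0 : ℝ), t ^ (-a - 1) * Real.exp (-B / t) = B ^ (-a) * Real.Gamma a := by
  have key : ∀ t ∈ Set.Ioi (0 : ℝ), t ^ ((-1 : ℝ) - 1) • ((t ^ (-1 : ℝ)) ^ (a - 1) *
      Real.exp (-(B * t ^ (-1 : ℝ)))) = t ^ (-a - 1) * Real.exp (-B / t) := by
    intro t ht
    have ht' : (0 : ℝ) < t := ht
    rw [← Real.rpow_mul ht'.le, smul_eq_mul, ← mul_assoc, ← Real.rpow_add ht', Real.rpow_neg_one]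
    congr 2
    · ring
    · field_simp
  constructor
  · have h := (integrableOn_Ioi_comp_rpow_iff' (fun u : ℝ => u ^ (a - 1) * Real.exp (-(B * u)))
      (p := -1) (by norm_num)).2 (by
        have := integrableOn_rpow_mul_exp_neg_mul_rpow (p := 1) (s := a - 1) (b := B)
          (by linarith) one_pos hB
        simpa using this)
    exact h.congr_fun key measurableSet_Ioi
  · have h := integral_comp_rpow_Ioi (fun u : ℝ => u ^ (a - 1) * Real.exp (-(B * u)))
      (p := -1) (by norm_num)
    rw [Real.integral_rpow_mul_exp_neg_mul_Ioi ha hB] at h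
    rw [Real.rpow_neg hB.le, ← Real.inv_rpow hB.le, ← one_div, ← h]
    refine setIntegral_congr_fun measurableSet_Ioi fun t ht => ?_
    rw [← key t ht]
    simp

lemma gauss_inner_aux (N m t : ℝ) (hN : 0 < N) (ht : 0 < t) :
    Integrable (fun μ : ℝ => Real.exp (-(N / (2 * t)) * (μ - m) ^ 2)) ∧
    ∫ μ : ℝ, Real.exp (-(N / (2 * t)) * (μ - m) ^ 2) = Real.sqrt (2 * π / N) * t ^ (1 / 2 : ℝ) := by
  constructor
  · exact (integrable_exp_neg_mul_sq (b := N / (2 * t)) (by positivity)).comp_sub_right m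
  · rw [integral_sub_right_eq_self (fun x : ℝ => Real.exp (-(N / (2 * t)) * x ^ 2)) m,
      integral_gaussian, ← Real.sqrt_eq_rpow, ← Real.sqrt_mul (by positivity)]
    congr 1
    field_simp

/-- Marginalization of the Gaussian block likelihood over the block mean μ
(flat prior) and block variance t (inverse-Gamma IG(α, β) prior):
∫_ℝ ∫_0^∞ t^{−n/2−α−1} exp(−(β + (1/2)∑_j (z_j − μ)²)/t) dt dμ converges
and equals √(2π/n)·Γ((n−1)/2 + α)·
[β + (1/2)∑_j z_j² − (∑_j z_j)²/(2n)]^{−((n−1)/2+α)}. -/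
theorem gaussian_inverse_gamma_marginalization (n : ℕ) (hn : 1 ≤ n)
    (z : Fin n → ℝ) (α β : ℝ) (hα : 0 < α) (hβ : 0 < β) :
    IntegrableOn
      (fun p : ℝ × ℝ =>
        p.2 ^ (-(n : ℝ) / 2 - α - 1) *
          Real.exp (-(β + (1 / 2) * ∑ j : Fin n, (z j - p.1) ^ 2) / p.2))
      (Set.univ ×ˢ Set.Ioi (0 : ℝ)) (volume.prod volume) ∧
    (∫ μ : ℝ, ∫ t in Set.Ioi (0 : ℝ),
        t ^ (-(n : ℝ) / 2 - α - 1) *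
          Real.exp (-(β + (1 / 2) * ∑ j : Fin n, (z j - μ) ^ 2) / t))
      = Real.sqrt (2 * π / n) * Real.Gamma (((n : ℝ) - 1) / 2 + α) *
        (β + (1 / 2) * ∑ j : Fin n, (z j) ^ 2 -
            (∑ j : Fin n, z j) ^ 2 / (2 * n)) ^
          (-(((n : ℝ) - 1) / 2 + α)) := by
  have hN : (0 : ℝ) < n := by exact_mod_cast hn
  set N : ℝ := (n : ℝ) with hNdef
  set S : ℝ := ∑ j : Fin n, z j with hS
  set Q : ℝ := ∑ j : Fin n, (z j) ^ 2 with hQ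
  set B : ℝ := β + (1 / 2) * Q - S ^ 2 / (2 * N) with hBdef
  set a : ℝ := (N - 1) / 2 + α with hadef
  have hN1 : (1 : ℝ) ≤ N := by rw [hNdef]; exact_mod_cast hn
  have ha : 0 < a := by rw [hadef]; linarith
  have hB : 0 < B := by
    have h := sq_sum_le_card_mul_sum_sq (s := (Finset.univ : Finset (Fin n))) (f := z)
    simp only [Finset.card_univ, Fintype.card_fin] at h
    have h2 : S ^ 2 / (2 * N) ≤ (1 / 2) * Q := by
      rw [div_le_iff₀ (by positivity)]
      have h3 : S ^ 2 ≤ N * Q := h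
      linarith
    rw [hBdef]; linarith
  have hsq : ∀ μ : ℝ, β + (1 / 2) * ∑ j : Fin n, (z j - μ) ^ 2 =
      B + N / 2 * (μ - S / N) ^ 2 := by
    intro μ
    have h1 : ∑ j : Fin n, (z j - μ) ^ 2 = Q - 2 * μ * S + N * μ ^ 2 := by
      simp only [sub_sq, Finset.sum_add_distrib, Finset.sum_sub_distrib, Finset.sum_const,
        Finset.card_univ, Fintype.card_fin, nsmul_eq_mul, hQ, hS, Finset.mul_sum, hNdef]
      congr 2
      exact Finset.sum_congr rfl fun j _ => by ring
    rw [h1, hBdef]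
    field_simp
    ring
  simp_rw [hsq]
  have hfac : ∀ μ t : ℝ, t ^ (-N / 2 - α - 1) * Real.exp (-(B + N / 2 * (μ - S / N) ^ 2) / t) =
      (t ^ (-N / 2 - α - 1) * Real.exp (-B / t)) *
        Real.exp (-(N / (2 * t)) * (μ - S / N) ^ 2) := by
    intro μ t
    rw [mul_assoc, ← Real.exp_add]
    congr 2
    rcases eq_or_ne t 0 with rfl | h
    · simp
    · field_simp
      ring
  simp_rw [hfac]
  have hout : ∀ t ∈ Set.Ioi (0 : ℝ), ∫ μ : ℝ, (t ^ (-N / 2 - α - 1) * Real.exp (-B / t)) *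
        Real.exp (-(N / (2 * t)) * (μ - S / N) ^ 2) =
      Real.sqrt (2 * π / N) * (t ^ (-a - 1) * Real.exp (-B / t)) := by
    intro t ht
    have ht' : (0 : ℝ) < t := ht
    rw [integral_const_mul, (gauss_inner_aux N (S / N) t hN ht').2]
    have : t ^ (-a - 1) = t ^ (-N / 2 - α - 1) * t ^ (1 / 2 : ℝ) := by
      rw [← Real.rpow_add ht']
      congr 1
      rw [hadef]; ring
    rw [this]; ring
  obtain ⟨hI1, hI2⟩ := invGamma_integral_aux a B ha hB
  have hint : Integrable (fun p : ℝ × ℝ => (p.2 ^ (-N / 2 - α - 1) * Real.exp (-B / p.2)) *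
        Real.exp (-(N / (2 * p.2)) * (p.1 - S / N) ^ 2))
      (volume.prod (volume.restrict (Set.Ioi (0 : ℝ)))) := by
    refine (integrable_prod_iff' (Measurable.aestronglyMeasurable (by fun_prop))).2 ⟨?_, ?_⟩
    · filter_upwards [ae_restrict_mem measurableSet_Ioi] with t ht
      exact (gauss_inner_aux N (S / N) t hN ht).1.const_mul _
    · refine IntegrableOn.congr_fun (hI1.const_mul (Real.sqrt (2 * π / N))) ?_ measurableSet_Ioi
      intro t ht
      have ht' : (0 : ℝ) < t := ht
      simp only
      rw [← hout t ht]
      refine integral_congr_ae (Filter.Eventually.of_forall fun μ => ?_)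
      simp only
      rw [Real.norm_of_nonneg (by positivity)]
  constructor
  · rw [IntegrableOn, ← Measure.prod_restrict, Measure.restrict_univ]
    exact hint
  · rw [integral_integral_swap hint, setIntegral_congr_fun measurableSet_Ioi hout,
      integral_const_mul, hI2]
    ring
end
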